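/- arXiv:math/0506455 — 7 statements merged into one kernel-verified Lean document; each statement's English description precedes it below -/
import Mathlib

section
/- Let R be a commutative ring, let p be a prime number, and let t, x, y, z ∈ R satisfy z ≡ p·x + t·y modulo the ideal generated by p·t. Then for every k ≥ 0 one has z^(p^k) ≡ p^(p^k)·x^(p^k) + t^(p^k)·y^(p^k) modulo the ideal generated by p^(k+1)·t. -/
/-- Lemma (pku->p(k+1)u): if `z ≡ p·x + t·y mod (p·t)` then for all `k ≥ 0`,
`z^(p^k) ≡ p^(p^k)·x^(p^k) + t^(p^k)·y^(p^k) mod (p^(k+1)·t)`. -/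
theorem stmt0 (R : Type*) [CommRing R] (p : ℕ) (hp : p.Prime) (t x y z : R)
    (h : z - ((p : R) * x + t * y) ∈ Ideal.span {(p : R) * t}) :
    ∀ k : ℕ,
      z ^ (p ^ k) - ((p : R) ^ (p ^ k) * x ^ (p ^ k) + t ^ (p ^ k) * y ^ (p ^ k))
        ∈ Ideal.span {(p : R) ^ (k + 1) * t} := by
  intro k
  induction k with
  | zero => simpa using h
  | succ k ih =>
    rw [Ideal.mem_span_singleton] at ih ⊢
    simp only [← mul_pow, pow_succ p k, pow_mul] at ih ⊢
    set A := ((p : R) * x) ^ p ^ k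
    set B := (t * y) ^ p ^ k
    obtain ⟨C, hC⟩ : ∃ C, C = z ^ p ^ k - (A + B) := ⟨_, rfl⟩
    rw [← hC] at ih
    obtain ⟨r, hr⟩ := exists_add_pow_prime_eq hp (A + B) C
    obtain ⟨s, hs⟩ := exists_add_pow_prime_eq hp A B
    have hpC : (p : R) ^ (k + 1 + 1) * t ∣ p * C := by
      rw [pow_succ', mul_assoc]
      exact mul_dvd_mul_left _ ih
    have hCp : (p : R) ^ (k + 1 + 1) * t ∣ C ^ p := by
      refine hpC.trans (dvd_trans ?_ (pow_dvd_pow C hp.two_le))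
      rw [sq]
      exact mul_dvd_mul_right (((dvd_pow_self _ k.succ_ne_zero).mul_right t).trans ih) C
    have hAB : (p : R) ^ (k + 1 + 1) * t ∣ p * (A * B) := by
      rw [pow_succ', mul_assoc]
      refine mul_dvd_mul_left _ (mul_dvd_mul ?_ ?_)
      · exact (pow_dvd_pow _ (Nat.lt_pow_self hp.one_lt)).trans
          (pow_dvd_pow_of_dvd (Dvd.intro _ rfl) _)
      · exact (Dvd.intro y rfl).trans (dvd_pow_self _ (pow_pos hp.pos k).ne')
    have key : (z ^ p ^ k) ^ p - (A ^ p + B ^ p)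
        = C ^ p + p * C * ((A + B) * r) + p * (A * B) * s := by
      rw [show z ^ p ^ k = A + B + C by rw [hC]; ring, hr, hs]
      ring
    rw [key]
    exact dvd_add (dvd_add hCp (hpC.mul_right _)) (hAB.mul_right _)
end

section
/- Let p be a prime and let R = ℚ[u, t_1, t_2, …] be the polynomial ring over ℚ in variables u and t_i (i ≥ 1). Set v_1 = p·t_1 + u and, for each n ≥ 2, set v_n = p·t_n + u·t_{n−1}^p − u^(p^{n−1})·t_{n−1} + p·s'_n + u·s''_n, where s'_n and s''_n are arbitrary elements of the ℚ-subalgebra of R generated by u, t_1, …, t_{n−1}. Then the sequence v_2, v_3, … is a regular sequence in R (i.e. for every m ≥ 2 the image of v_m in R/(v_2, …, v_{m−1}) is a nonzerodivisor and the quotient is nonzero), and the ℚ-algebra homomorphism ℚ[U, T] → R/(v_n : n ≥ 2) sending U to the class of u and T to the class of t_1 is an isomorphism. -/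
open MvPolynomial

section Triangular

variable {k : Type*} [Field k] (c : ℕ → k) (g : ℕ → MvPolynomial ℕ k)

/-- The recursively defined images of the variables under the inverse of the triangular
substitution `X n ↦ c n X n + g n`. -/
noncomputable def triangularInv (n : ℕ) : MvPolynomial ℕ k :=
  C (c n)⁻¹ * (X n - aeval (fun i : ℕ => if _ : i < n then triangularInv i else 0) (g n))

variable {c g}

/-- Algebra homomorphisms agreeing on the variables below `n` agree on the polynomials in these
variables. -/
theorem algHom_eq_of_mem_supported_Iio {A : Type*} [CommRing A] [Algebra k A]
    {φ ψ : MvPolynomial ℕ k →ₐ[k] A} {n : ℕ} (h : ∀ i < n, φ (X i) = ψ (X i))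
    {q : MvPolynomial ℕ k} (hq : q ∈ supported k (Set.Iio n)) : φ q = ψ q := by
  have hle : supported k (Set.Iio n) ≤ AlgHom.equalizer φ ψ := by
    refine Algebra.adjoin_le ?_
    rintro _ ⟨i, hi, rfl⟩
    exact h i hi
  exact hle hq

/-- A triangular substitution with nonzero diagonal is an automorphism. -/
theorem exists_algEquiv_of_triangular (hc : ∀ n, c n ≠ 0)
    (hg : ∀ n, g n ∈ supported k (Set.Iio n)) :
    ∃ e : MvPolynomial ℕ k ≃ₐ[k] MvPolynomial ℕ k, ∀ n, e (X n) = C (c n) * X n + g n := by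
  set φ : MvPolynomial ℕ k →ₐ[k] MvPolynomial ℕ k := aeval fun n => C (c n) * X n + g n with hφ
  set ψ : MvPolynomial ℕ k →ₐ[k] MvPolynomial ℕ k := aeval (triangularInv c g) with hψ
  have hφX (n : ℕ) : φ (X n) = C (c n) * X n + g n := by simp [hφ]
  have hψX (n : ℕ) : ψ (X n) = C (c n)⁻¹ * (X n - ψ (g n)) := by
    rw [hψ, aeval_X, triangularInv]
    congr 2
    refine algHom_eq_of_mem_supported_Iio (fun i hi => ?_) (hg n)
    simp [hi]
  have hCC (n : ℕ) : (C (c n) * C (c n)⁻¹ : MvPolynomial ℕ k) = 1 := by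
    rw [← C_mul, mul_inv_cancel₀ (hc n), C_1]
  have hC (χ : MvPolynomial ℕ k →ₐ[k] MvPolynomial ℕ k) (a : k) : χ (C a) = C a :=
    χ.commutes a
  have hψφ : ψ.comp φ = AlgHom.id k _ := by
    ext1 n
    rw [AlgHom.comp_apply, hφX, map_add, map_mul, hC, hψX, AlgHom.id_apply]
    linear_combination (X n - ψ (g n)) * hCC n
  have hφψX (n : ℕ) : φ (ψ (X n)) = X n := by
    induction n using Nat.strong_induction_on with
    | _ n ih =>
      have h : φ.comp ψ (g n) = AlgHom.id k _ (g n) :=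
        algHom_eq_of_mem_supported_Iio (fun i hi => ih i hi) (hg n)
      rw [AlgHom.comp_apply, AlgHom.id_apply] at h
      rw [hψX, map_mul, map_sub, hC, hφX, h]
      linear_combination X n * hCC n
  have hφψ : φ.comp ψ = AlgHom.id k _ := by
    ext1 n
    exact hφψX n
  exact ⟨AlgEquiv.ofAlgHom φ ψ hφψ hψφ, hφX⟩

end Triangular

/-- A variable outside `s` is a nonzerodivisor modulo the ideal generated by the variables
in `s`. -/
theorem mem_span_X_image_of_mul_X_mem {σ k : Type*} [CommSemiring k] {s : Set σ} {m : σ}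
    (hm : m ∉ s) {q : MvPolynomial σ k}
    (h : q * X m ∈ Ideal.span (X '' s : Set (MvPolynomial σ k))) :
    q ∈ Ideal.span (X '' s : Set (MvPolynomial σ k)) := by
  classical
  rw [mem_ideal_span_X_image] at h ⊢
  intro d hd
  obtain ⟨i, hi, hdi⟩ := h (d + Finsupp.single m 1) (by
    rw [mem_support_iff] at hd ⊢
    rwa [coeff_mul_X])
  refine ⟨i, hi, ?_⟩
  have hmi : m ≠ i := fun hmi => hm (hmi ▸ hi)
  simpa [Finsupp.single_apply, hmi] using hdi

theorem span_X_image_ne_top {σ k : Type*} [CommSemiring k] [Nontrivial k] (s : Set σ) :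
    Ideal.span (X '' s : Set (MvPolynomial σ k)) ≠ ⊤ := by
  rw [Ne, Ideal.eq_top_iff_one, mem_ideal_span_X_image]
  intro h
  obtain ⟨i, -, hi⟩ := h 0 (by simp)
  exact hi rfl

/-- The variables from `X 2` on generate an ideal of which the polynomials in `X 0` and `X 1`
are a complement; this is transported along an automorphism `e` fixing `X 0` and `X 1`. -/
theorem bijective_aeval_mk_of_algEquiv {k : Type*} [Field k]
    (e : MvPolynomial ℕ k ≃ₐ[k] MvPolynomial ℕ k) (h0 : e (X 0) = X 0) (h1 : e (X 1) = X 1)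
    {I : Ideal (MvPolynomial ℕ k)} (hI : I = Ideal.span (e '' (X '' Set.Ici 2))) :
    Function.Bijective (aeval ![Ideal.Quotient.mk I (X 0), Ideal.Quotient.mk I (X 1)] :
      MvPolynomial (Fin 2) k →ₐ[k] MvPolynomial ℕ k ⧸ I) := by
  set F : MvPolynomial (Fin 2) k →ₐ[k] MvPolynomial ℕ k ⧸ I :=
    aeval ![Ideal.Quotient.mk I (X 0), Ideal.Quotient.mk I (X 1)] with hF
  constructor
  · let ρ : MvPolynomial ℕ k →ₐ[k] MvPolynomial (Fin 2) k :=
      (aeval fun n => if n = 0 then X 0 else if n = 1 then X 1 else 0).comp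
        (e.symm : MvPolynomial ℕ k →ₐ[k] MvPolynomial ℕ k)
    have hρe (q) : ρ (e q) =
        aeval (fun n => if n = 0 then X 0 else if n = 1 then X 1 else 0) q := by
      simp [ρ]
    have hρ : ∀ a ∈ I, ρ a = 0 := by
      have hle : I ≤ RingHom.ker ρ := by
        rw [hI, Ideal.span_le]
        rintro _ ⟨_, ⟨n, hn, rfl⟩, rfl⟩
        have hn : 2 ≤ n := hn
        have hn0 : n ≠ 0 := by omega
        have hn1 : n ≠ 1 := by omega
        simp [RingHom.mem_ker, hρe, hn0, hn1]
      exact fun a ha => hle ha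
    have hcomp : (Ideal.Quotient.liftₐ I ρ hρ).comp F = AlgHom.id k _ := by
      have hρ0 : ρ (X 0) = X 0 := by
        have h := hρe (X 0)
        rwa [h0, aeval_X, if_pos rfl] at h
      have hρ1 : ρ (X 1) = X 1 := by
        have h := hρe (X 1)
        rwa [h1, aeval_X, if_neg one_ne_zero, if_pos rfl] at h
      ext1 i
      fin_cases i
      · change Ideal.Quotient.liftₐ I ρ hρ (F (X 0)) = X 0
        rw [hF, aeval_X]
        exact hρ0
      · change Ideal.Quotient.liftₐ I ρ hρ (F (X 1)) = X 1
        rw [hF, aeval_X]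
        exact hρ1
    exact Function.LeftInverse.injective fun q => DFunLike.congr_fun hcomp q
  · have hle : Algebra.adjoin k (Set.range X) ≤
        F.range.comap ((Ideal.Quotient.mkₐ k I).comp
          (e : MvPolynomial ℕ k →ₐ[k] MvPolynomial ℕ k)) := by
      refine Algebra.adjoin_le ?_
      rintro _ ⟨n, rfl⟩
      change Ideal.Quotient.mk I (e (X n)) ∈ F.range
      rcases lt_or_ge n 2 with hn | hn
      · interval_cases n
        · exact ⟨X 0, by simp [hF, h0]⟩
        · exact ⟨X 1, by simp [hF, h1]⟩
      · have hmem : e (X n) ∈ I := by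
          rw [hI]
          exact Ideal.subset_span ⟨X n, ⟨n, hn, rfl⟩, rfl⟩
        rw [Ideal.Quotient.eq_zero_iff_mem.mpr hmem]
        exact zero_mem _
    rw [adjoin_range_X] at hle
    intro y
    obtain ⟨r, rfl⟩ := Ideal.Quotient.mk_surjective y
    obtain ⟨q, rfl⟩ := e.surjective r
    exact hle (Algebra.mem_top (x := q))

/-- Proposition (RegSeq-p): in `R = ℚ[u, t₁, t₂, …]` (here `u = X 0`, `tᵢ = X i` for `i ≥ 1`),
with `v₁ = p t₁ + u` and `vₙ = p tₙ + u tₙ₋₁^p − u^(p^(n−1)) tₙ₋₁ + p s'ₙ + u s''ₙ` for `n ≥ 2`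
(`s'ₙ, s''ₙ` in the subalgebra generated by `u, t₁, …, tₙ₋₁`), the sequence `v₂, v₃, …` is
regular and `R/(vₙ : n ≥ 2) ≅ ℚ[U, T]` via `U ↦ u`, `T ↦ t₁`. -/
theorem stmt1 (p : ℕ) (hp : p.Prime) (v s' s'' : ℕ → MvPolynomial ℕ ℚ)
    (hs' : ∀ n, 2 ≤ n → s' n ∈ Algebra.adjoin ℚ
      (({X 0} ∪ {y | ∃ i, 1 ≤ i ∧ i ≤ n - 1 ∧ y = X i}) : Set (MvPolynomial ℕ ℚ)))
    (hs'' : ∀ n, 2 ≤ n → s'' n ∈ Algebra.adjoin ℚ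
      (({X 0} ∪ {y | ∃ i, 1 ≤ i ∧ i ≤ n - 1 ∧ y = X i}) : Set (MvPolynomial ℕ ℚ)))
    (hv1 : v 1 = (p : MvPolynomial ℕ ℚ) * X 1 + X 0)
    (hv : ∀ n, 2 ≤ n → v n =
      (p : MvPolynomial ℕ ℚ) * X n + X 0 * (X (n - 1)) ^ p
        - (X 0) ^ (p ^ (n - 1)) * X (n - 1) + (p : MvPolynomial ℕ ℚ) * s' n + X 0 * s'' n) :
    (∀ m, 2 ≤ m →
      (∀ r : MvPolynomial ℕ ℚ,
        r * v m ∈ Ideal.span {y | ∃ k, 2 ≤ k ∧ k < m ∧ y = v k} →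
          r ∈ Ideal.span {y | ∃ k, 2 ≤ k ∧ k < m ∧ y = v k}) ∧
      Ideal.span {y | ∃ k, 2 ≤ k ∧ k < m ∧ y = v k} ≠ (⊤ : Ideal (MvPolynomial ℕ ℚ))) ∧
    Function.Bijective
      (MvPolynomial.aeval
        ![Ideal.Quotient.mk (Ideal.span {y | ∃ n, 2 ≤ n ∧ y = v n}) (X 0),
          Ideal.Quotient.mk (Ideal.span {y | ∃ n, 2 ≤ n ∧ y = v n}) (X 1)] :
        MvPolynomial (Fin 2) ℚ →ₐ[ℚ]
          MvPolynomial ℕ ℚ ⧸ Ideal.span {y | ∃ n, 2 ≤ n ∧ y = v n}) := by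
  have hp0 : (p : ℚ) ≠ 0 := Nat.cast_ne_zero.mpr hp.ne_zero
  set c : ℕ → ℚ := fun n => if n < 2 then 1 else p with hcdef
  set g : ℕ → MvPolynomial ℕ ℚ := fun n => if n < 2 then 0 else
    X 0 * (X (n - 1)) ^ p - (X 0) ^ (p ^ (n - 1)) * X (n - 1)
      + (p : MvPolynomial ℕ ℚ) * s' n + X 0 * s'' n with hgdef
  have hc : ∀ n, c n ≠ 0 := by
    intro n
    simp only [hcdef]
    split_ifs
    exacts [one_ne_zero, hp0]
  have hg : ∀ n, g n ∈ supported ℚ (Set.Iio n) := by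
    intro n
    rcases lt_or_ge n 2 with hn | hn
    · simp only [hgdef, if_pos hn]
      exact zero_mem _
    have hle : Algebra.adjoin ℚ (({X 0} ∪ {y | ∃ i, 1 ≤ i ∧ i ≤ n - 1 ∧ y = X i}) :
        Set (MvPolynomial ℕ ℚ)) ≤ supported ℚ (Set.Iio n) := by
      refine Algebra.adjoin_mono ?_
      rintro _ (rfl | ⟨i, -, hi, rfl⟩)
      · exact ⟨0, Set.mem_Iio.mpr (by omega), rfl⟩
      · exact ⟨i, Set.mem_Iio.mpr (by omega), rfl⟩
    have hX (i : ℕ) (hi : i < n) : (X i : MvPolynomial ℕ ℚ) ∈ supported ℚ (Set.Iio n) :=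
      X_mem_supported.mpr hi
    have h0 := hX 0 (by omega)
    have hpred := hX (n - 1) (by omega)
    simp only [hgdef, if_neg hn.not_gt]
    exact add_mem (add_mem (sub_mem (mul_mem h0 (pow_mem hpred _))
      (mul_mem (pow_mem h0 _) hpred)) (mul_mem (natCast_mem _ p) (hle (hs' n hn))))
      (mul_mem h0 (hle (hs'' n hn)))
  obtain ⟨e, he⟩ := exists_algEquiv_of_triangular hc hg
  have hev (n : ℕ) (hn : 2 ≤ n) : e (X n) = v n := by
    rw [he, hv n hn]
    simp only [hcdef, hgdef, if_neg hn.not_gt, map_natCast]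
    ring
  have he0 : e (X 0) = X 0 := by simp [he, hcdef, hgdef]
  have he1 : e (X 1) = X 1 := by simp [he, hcdef, hgdef]
  refine ⟨fun m hm => ?_, ?_⟩
  · have hset : ({y | ∃ k, 2 ≤ k ∧ k < m ∧ y = v k} : Set (MvPolynomial ℕ ℚ)) =
        e '' (X '' Set.Ico 2 m) := by
      ext y
      constructor
      · rintro ⟨k, hk, hkm, rfl⟩
        exact ⟨X k, ⟨k, ⟨hk, hkm⟩, rfl⟩, hev k hk⟩
      · rintro ⟨_, ⟨k, ⟨hk, hkm⟩, rfl⟩, rfl⟩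
        exact ⟨k, hk, hkm, hev k hk⟩
    have hmem (q : MvPolynomial ℕ ℚ) : e q ∈ Ideal.span (e '' (X '' Set.Ico 2 m)) ↔
        q ∈ Ideal.span (X '' Set.Ico 2 m : Set (MvPolynomial ℕ ℚ)) := by
      rw [← Ideal.map_span e, Ideal.mem_map_of_equiv]
      simp
    rw [hset]
    refine ⟨fun r hr => ?_, fun htop => ?_⟩
    · obtain ⟨q, rfl⟩ := e.surjective r
      rw [← hev m hm, ← map_mul, hmem] at hr
      exact (hmem q).mpr (mem_span_X_image_of_mul_X_mem (by simp) hr)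
    · refine span_X_image_ne_top (k := ℚ) (Set.Ico 2 m) ?_
      rw [Ideal.eq_top_iff_one, ← hmem, htop]
      exact Submodule.mem_top
  · refine bijective_aeval_mk_of_algEquiv e he0 he1 (congrArg Ideal.span ?_)
    ext y
    constructor
    · rintro ⟨n, hn, rfl⟩
      exact ⟨X n, ⟨n, hn, rfl⟩, hev n hn⟩
    · rintro ⟨_, ⟨n, hn, rfl⟩, rfl⟩
      exact ⟨n, hn, hev n hn⟩
end

section
/- In the exterior algebra Λ over a commutative ring R on generators e_1, e_2, …, with a fixed sequence w : {1,2,…} → R and Δ defined as below, let r, s ≥ 2 and let (i_1, …, i_r) and (j_1, …, j_s) be tuples of pairwise distinct positive integers (each tuple has distinct entries). If the two underlying sets {i_1, …, i_r} and {j_1, …, j_s} have at least two elements in common (equivalently, the cardinality of their union is at most r + s − 2), then Δ(i_1, …, i_r) · Δ(j_1, …, j_s) = 0 in Λ. -/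
/-- The exterior generator `e_i` of `Λ = Λ_R(e_i : i ≥ 1)`. -/
noncomputable def extGen {R : Type*} [CommRing R] (i : ℕ+) :
    ExteriorAlgebra R (ℕ+ →₀ R) :=
  ExteriorAlgebra.ι R (Finsupp.single i 1)

/-- `Δ(i₁,…,i_m) = Σ_{k=1}^m (−1)^k w_{i_k} e_{i₁}⋯ê_{i_k}⋯e_{i_m}` (zero-based: `(−1)^(k+1)`). -/
noncomputable def Delta {R : Type*} [CommRing R] (w : ℕ+ → R) (l : List ℕ+) :
    ExteriorAlgebra R (ℕ+ →₀ R) :=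
  ∑ k ∈ Finset.range l.length,
    ((-1 : ℤ) ^ (k + 1)) • (w (l.getD k 1) • ((l.eraseIdx k).map (extGen (R := R))).prod)

/-- The linear functional on the free module sending the `i`-th basis vector to `w i`. -/
noncomputable def weightFunctional {R : Type*} [CommRing R] (w : ℕ+ → R) :
    Module.Dual R (ℕ+ →₀ R) :=
  Finsupp.linearCombination R w

/-- Contraction by `weightFunctional w`, as an endomorphism of the exterior algebra. -/
noncomputable def weightContraction {R : Type*} [CommRing R] (w : ℕ+ → R) :
    ExteriorAlgebra R (ℕ+ →₀ R) →ₗ[R] ExteriorAlgebra R (ℕ+ →₀ R) :=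
  CliffordAlgebra.contractLeft (Q := (0 : QuadraticForm R (ℕ+ →₀ R))) (weightFunctional w)

theorem weightContraction_extGen_mul {R : Type*} [CommRing R] (w : ℕ+ → R) (i : ℕ+)
    (x : ExteriorAlgebra R (ℕ+ →₀ R)) :
    weightContraction w (extGen i * x) = w i • x - extGen i * weightContraction w x := by
  have h := CliffordAlgebra.contractLeft_ι_mul (Q := (0 : QuadraticForm R (ℕ+ →₀ R)))
    (d := weightFunctional w) (Finsupp.single i 1) x
  have hi : weightFunctional w (Finsupp.single i 1) = w i := by simp [weightFunctional]
  rw [hi] at h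
  exact h

theorem weightContraction_one {R : Type*} [CommRing R] (w : ℕ+ → R) :
    weightContraction w 1 = 0 :=
  CliffordAlgebra.contractLeft_one (Q := (0 : QuadraticForm R (ℕ+ →₀ R))) _

theorem weightContraction_weightContraction {R : Type*} [CommRing R] (w : ℕ+ → R)
    (x : ExteriorAlgebra R (ℕ+ →₀ R)) :
    weightContraction w (weightContraction w x) = 0 :=
  CliffordAlgebra.contractLeft_contractLeft (Q := (0 : QuadraticForm R (ℕ+ →₀ R))) _ x

theorem weightContraction_prod_mul_of_eq_zero {R : Type*} [CommRing R] (w : ℕ+ → R)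
    (l : List ℕ+) {x : ExteriorAlgebra R (ℕ+ →₀ R)} (hx : weightContraction w x = 0) :
    weightContraction w ((l.map extGen).prod * x) =
      weightContraction w (l.map extGen).prod * x := by
  induction l with
  | nil => simp [hx, weightContraction_one]
  | cons a l ih =>
    simp only [List.map_cons, List.prod_cons, mul_assoc, weightContraction_extGen_mul, ih,
      sub_mul, smul_mul_assoc]

theorem Delta_cons {R : Type*} [CommRing R] (w : ℕ+ → R) (a : ℕ+) (l : List ℕ+) :
    Delta w (a :: l) = -(w a • (l.map extGen).prod) - extGen a * Delta w l := by
  simp only [Delta, List.length_cons, Finset.sum_range_succ', Finset.mul_sum]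
  rw [add_comm, sub_eq_add_neg, ← Finset.sum_neg_distrib]
  congr 1
  · simp
  · refine Finset.sum_congr rfl fun k _ => ?_
    simp only [pow_succ (-1 : ℤ) (k + 1), mul_neg, mul_one, neg_smul, List.getD_cons_succ,
      List.eraseIdx_cons_succ, List.map_cons, List.prod_cons, mul_smul_comm]

theorem Delta_eq_neg_weightContraction {R : Type*} [CommRing R] (w : ℕ+ → R) (l : List ℕ+) :
    Delta w l = -weightContraction w (l.map extGen).prod := by
  induction l with
  | nil => simp [Delta, weightContraction_one]
  | cons a l ih =>
    rw [Delta_cons, ih, List.map_cons, List.prod_cons, weightContraction_extGen_mul]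
    noncomm_ring

theorem prod_extGen_eq_zero_of_not_nodup {R : Type*} [CommRing R] {l : List ℕ+}
    (hl : ¬ l.Nodup) : (l.map (extGen (R := R))).prod = 0 := by
  have h := (ExteriorAlgebra.ιMulti R l.length).map_eq_zero_of_not_injective
    (fun i => Finsupp.single (l.get i) (1 : R)) fun hinj =>
      hl (List.nodup_iff_injective_get.2 fun i j hij => hinj (by simp only [hij]))
  rw [ExteriorAlgebra.ιMulti_apply] at h
  rw [← h]
  congr 1
  exact List.ext_getElem (by simp) fun i _ _ => by simp [extGen]

theorem prod_extGen_mul_Delta_eq_zero {R : Type*} [CommRing R] (w : ℕ+ → R) (l₁ l₂ : List ℕ+)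
    (hcommon : 2 ≤ (l₁.toFinset ∩ l₂.toFinset).card) :
    (l₁.map extGen).prod * Delta w l₂ = 0 := by
  rw [Delta, Finset.mul_sum]
  refine Finset.sum_eq_zero fun k hk => ?_
  have hk : k < l₂.length := Finset.mem_range.1 hk
  obtain ⟨c, hc, hck⟩ := Finset.exists_mem_ne hcommon l₂[k]
  rw [Finset.mem_inter, List.mem_toFinset, List.mem_toFinset] at hc
  obtain ⟨i, hi, rfl⟩ := List.mem_iff_getElem.1 hc.2
  have hmem : l₂[i] ∈ l₂.eraseIdx k :=
    List.mem_eraseIdx_iff_getElem.2 ⟨i, hi, fun h => hck (by simp only [h]), rfl⟩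
  have h : ((l₁ ++ l₂.eraseIdx k).map (extGen (R := R))).prod = 0 :=
    prod_extGen_eq_zero_of_not_nodup fun hn =>
      (List.disjoint_of_nodup_append hn) hc.1 hmem
  rw [List.map_append, List.prod_append] at h
  rw [mul_smul_comm, mul_smul_comm, h, smul_zero, smul_zero]

/-- Relation (GenKosComp-RelationsP), case `t ≤ r + s − 2`: if the two index tuples share at
least two elements then `Δ(i₁,…,i_r) · Δ(j₁,…,j_s) = 0`. -/
theorem stmt7 {R : Type*} [CommRing R] (w : ℕ+ → R) (l₁ l₂ : List ℕ+)
    (h₁ : l₁.Nodup) (h₂ : l₂.Nodup) (hr : 2 ≤ l₁.length) (hs : 2 ≤ l₂.length)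
    (hcommon : 2 ≤ (l₁.toFinset ∩ l₂.toFinset).card) :
    Delta w l₁ * Delta w l₂ = 0 := by
  have hclosed : weightContraction w (Delta w l₂) = 0 := by
    rw [Delta_eq_neg_weightContraction, map_neg, weightContraction_weightContraction, neg_zero]
  rw [Delta_eq_neg_weightContraction w l₁, neg_mul,
    ← weightContraction_prod_mul_of_eq_zero w l₁ hclosed,
    prod_extGen_mul_Delta_eq_zero w l₁ l₂ hcommon, map_zero, neg_zero]
end

section
/- Let R be a commutative ring, x ∈ R a nonzerodivisor which is not a unit, and w_1, w_2, … a sequence in R which is regular in R and whose reduction is regular in R/(x), and let (K', d') be the generalized Koszul complex with d'(e_I) = Σ_k (−1)^{k−1}·x·w_{i_k}·e_{I minus i_k} as defined below. Then for every n ≥ 1 and every z ∈ K'_n with d'(z) = 0, the element x·z lies in the image of d' : K'_{n+1} → K'_n. In particular x annihilates the n-th homology of (K', d') for all n ≥ 1. -/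
/-- The generalized Koszul complex `Λ_R(e'_r : r ≥ 1)` with `d'(e'_r) = x·w_r`, on its
canonical basis: degree `n` is the free module on strictly increasing `n`-tuples of positive
integers, and `d' e_{(i₁,…,i_{n+1})} = Σ_k (−1)^(k−1) x w_{i_k} e_{(i₁,…,î_k,…,i_{n+1})}`.
Here `koszulD w'` with `w' = fun i => x * w i` gives `d'`. -/
noncomputable def koszulD {R : Type*} [CommRing R] (w : ℕ+ → R) (n : ℕ) :
    ({f : Fin (n + 1) → ℕ+ // StrictMono f} →₀ R) →ₗ[R]
      ({f : Fin n → ℕ+ // StrictMono f} →₀ R) :=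
  Finsupp.lsum R fun I =>
    LinearMap.smulRight (LinearMap.id : R →ₗ[R] R)
      (∑ k : Fin (n + 1),
        Finsupp.single ⟨I.1 ∘ k.succAbove, I.2.comp (Fin.strictMono_succAbove k)⟩
          ((-1 : R) ^ (k : ℕ) * w (I.1 k)))

/-- The span of the basis symbols `e_I` of degree `n` all of whose indices are at most `m`. -/
noncomputable def koszulSupported (R : Type*) [CommRing R] (n m : ℕ) :
    Submodule R ({f : Fin n → ℕ+ // StrictMono f} →₀ R) :=
  Finsupp.supported R R {I | ∀ i, (I.1 i : ℕ) ≤ m}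

theorem strictMono_snoc {n : ℕ} {f : Fin n → ℕ+} (hf : StrictMono f) {p : ℕ+}
    (h : ∀ i, f i < p) : StrictMono (Fin.snoc f p : Fin (n + 1) → ℕ+) := by
  intro i j hij
  induction j using Fin.lastCases with
  | last =>
    induction i using Fin.lastCases with
    | last => exact absurd hij (lt_irrefl _)
    | cast i => simpa using h i
  | cast j =>
    induction i using Fin.lastCases with
    | last => exact absurd hij (not_lt.mpr (Fin.le_last _))
    | cast i => simpa using hf (by simpa using hij)

/-- Right multiplication by `e_p` on the symbols whose indices are all less than `p`; the other
symbols are sent to `0`. -/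
noncomputable def koszulSnoc (R : Type*) [CommRing R] (n : ℕ) (p : ℕ+) :
    ({f : Fin n → ℕ+ // StrictMono f} →₀ R) →ₗ[R]
      ({f : Fin (n + 1) → ℕ+ // StrictMono f} →₀ R) :=
  Finsupp.lsum R fun I =>
    if h : ∀ i, I.1 i < p then Finsupp.lsingle ⟨Fin.snoc I.1 p, strictMono_snoc I.2 h⟩ else 0

/-- Removal of a final `e_p`; the symbols not ending in `e_p` are sent to `0`. -/
noncomputable def koszulInit (R : Type*) [CommRing R] (n : ℕ) (p : ℕ+) :
    ({f : Fin (n + 1) → ℕ+ // StrictMono f} →₀ R) →ₗ[R]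
      ({f : Fin n → ℕ+ // StrictMono f} →₀ R) :=
  Finsupp.lsum R fun I =>
    if I.1 (Fin.last n) = p then
      Finsupp.lsingle ⟨I.1 ∘ Fin.castSucc, I.2.comp Fin.strictMono_castSucc⟩ else 0

section

variable {R : Type*} [CommRing R]

theorem koszulD_single (w : ℕ+ → R) (n : ℕ) (I : {f : Fin (n + 1) → ℕ+ // StrictMono f})
    (r : R) :
    koszulD w n (Finsupp.single I r) = r • ∑ k : Fin (n + 1),
      Finsupp.single ⟨I.1 ∘ k.succAbove, I.2.comp (Fin.strictMono_succAbove k)⟩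
        ((-1 : R) ^ (k : ℕ) * w (I.1 k)) := by
  simp [koszulD]

theorem koszulD_smul (x : R) (w : ℕ+ → R) (n : ℕ)
    (z : {f : Fin (n + 1) → ℕ+ // StrictMono f} →₀ R) :
    koszulD (fun i => x * w i) n z = x • koszulD w n z := by
  induction z using Finsupp.induction_linear with
  | zero => simp
  | add f g hf hg => simp [hf, hg]
  | single I r =>
    rw [koszulD_single, koszulD_single, smul_comm x r, Finset.smul_sum (r := x)]
    congr 1
    refine Finset.sum_congr rfl fun k _ => ?_
    rw [Finsupp.smul_single, smul_eq_mul]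
    congr 1
    ring

theorem single_mem_koszulSupported {n m : ℕ} (I : {f : Fin n → ℕ+ // StrictMono f}) (r : R)
    (h : ∀ i, (I.1 i : ℕ) ≤ m) : Finsupp.single I r ∈ koszulSupported R n m :=
  Finsupp.single_mem_supported R r h

@[elab_as_elim]
theorem koszulSupported_induction {n m : ℕ}
    {p : (z : {f : Fin n → ℕ+ // StrictMono f} →₀ R) → z ∈ koszulSupported R n m → Prop}
    (zero : p 0 (zero_mem _))
    (add : ∀ a b (ha : a ∈ koszulSupported R n m) (hb : b ∈ koszulSupported R n m),
      p a ha → p b hb → p (a + b) (add_mem ha hb))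
    (single : ∀ (I : {f : Fin n → ℕ+ // StrictMono f}) (r : R) (h : ∀ i, (I.1 i : ℕ) ≤ m),
      p (Finsupp.single I r) (single_mem_koszulSupported I r h))
    {z : {f : Fin n → ℕ+ // StrictMono f} →₀ R} (hz : z ∈ koszulSupported R n m) : p z hz := by
  suffices h : ∃ h, p z h from h.2
  rw [← Finsupp.sum_single z]
  refine Finset.sum_induction _ (fun z => ∃ h, p z h)
    (fun a b ha hb => ⟨_, add a b ha.1 hb.1 ha.2 hb.2⟩) ⟨_, zero⟩ fun I hI => ?_
  exact ⟨_, single I _ ((Finsupp.mem_supported _ _).1 hz hI)⟩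

theorem koszulSupported_mono {n m k : ℕ} (h : m ≤ k) :
    koszulSupported R n m ≤ koszulSupported R n k :=
  Finsupp.supported_mono fun _ hI i => (hI i).trans h

theorem exists_mem_koszulSupported {n : ℕ} (z : {f : Fin n → ℕ+ // StrictMono f} →₀ R) :
    ∃ m, z ∈ koszulSupported R n m := by
  refine ⟨z.support.sup fun I => Finset.univ.sup fun i => (I.1 i : ℕ), ?_⟩
  refine (Finsupp.mem_supported _ _).2 fun I hI i => ?_
  exact (Finset.le_sup (f := fun i => (I.1 i : ℕ)) (Finset.mem_univ i)).trans
    (Finset.le_sup (f := fun I : {f : Fin n → ℕ+ // StrictMono f} =>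
      Finset.univ.sup fun i => (I.1 i : ℕ)) hI)

theorem koszulD_mem_koszulSupported (w : ℕ+ → R) {n m : ℕ}
    {z : {f : Fin (n + 1) → ℕ+ // StrictMono f} →₀ R} (hz : z ∈ koszulSupported R (n + 1) m) :
    koszulD w n z ∈ koszulSupported R n m := by
  induction hz using koszulSupported_induction with
  | zero => simp
  | add a b _ _ ha hb => rw [map_add]; exact add_mem ha hb
  | single I r h =>
    rw [koszulD_single]
    exact Submodule.smul_mem _ _ (sum_mem fun k _ => single_mem_koszulSupported _ _ fun i => h _)

theorem koszulSnoc_single {n : ℕ} {p : ℕ+} (I : {f : Fin n → ℕ+ // StrictMono f}) (r : R)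
    (h : ∀ i, I.1 i < p) :
    koszulSnoc R n p (Finsupp.single I r) =
      Finsupp.single ⟨Fin.snoc I.1 p, strictMono_snoc I.2 h⟩ r := by
  simp [koszulSnoc, h]

theorem lt_succPNat_iff {m : ℕ} {k : ℕ+} : k < m.succPNat ↔ (k : ℕ) ≤ m := by
  rw [← PNat.coe_lt_coe, Nat.succPNat_coe, Nat.lt_succ_iff]

theorem koszulSnoc_mem_koszulSupported {n m : ℕ}
    {b : {f : Fin n → ℕ+ // StrictMono f} →₀ R} (hb : b ∈ koszulSupported R n m) :
    koszulSnoc R n m.succPNat b ∈ koszulSupported R (n + 1) (m + 1) := by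
  induction hb using koszulSupported_induction with
  | zero => simp
  | add a b _ _ ha hb => rw [map_add]; exact add_mem ha hb
  | single I r h =>
    rw [koszulSnoc_single I r fun i => lt_succPNat_iff.2 (h i)]
    refine single_mem_koszulSupported _ _ fun i => ?_
    induction i using Fin.lastCases with
    | last => simp
    | cast i => simpa using (h i).trans (Nat.le_succ m)

theorem koszulInit_koszulSnoc {n m : ℕ}
    {b : {f : Fin n → ℕ+ // StrictMono f} →₀ R} (hb : b ∈ koszulSupported R n m) :
    koszulInit R n m.succPNat (koszulSnoc R n m.succPNat b) = b := by
  induction hb using koszulSupported_induction with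
  | zero => simp
  | add a b _ _ ha hb => rw [map_add, map_add, ha, hb]
  | single I r h =>
    rw [koszulSnoc_single I r fun i => lt_succPNat_iff.2 (h i)]
    simp only [koszulInit, Finsupp.lsum_single, Fin.snoc_last, if_true, Finsupp.lsingle_apply]
    congr 1
    ext i
    simp

theorem koszulInit_eq_zero {n m : ℕ}
    {a : {f : Fin (n + 1) → ℕ+ // StrictMono f} →₀ R} (ha : a ∈ koszulSupported R (n + 1) m) :
    koszulInit R n m.succPNat a = 0 := by
  induction ha using koszulSupported_induction with
  | zero => simp
  | add a b _ _ ha hb => rw [map_add, ha, hb, add_zero]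
  | single I r h =>
    simp [koszulInit, (lt_succPNat_iff.2 (h (Fin.last n))).ne]

theorem exists_eq_add_koszulSnoc {n m : ℕ}
    {z : {f : Fin (n + 1) → ℕ+ // StrictMono f} →₀ R}
    (hz : z ∈ koszulSupported R (n + 1) (m + 1)) :
    ∃ a ∈ koszulSupported R (n + 1) m, ∃ b ∈ koszulSupported R n m,
      z = a + koszulSnoc R n m.succPNat b := by
  induction hz using koszulSupported_induction with
  | zero => exact ⟨0, zero_mem _, 0, zero_mem _, by simp⟩
  | add z z' _ _ h h' =>
    obtain ⟨a, ha, b, hb, rfl⟩ := h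
    obtain ⟨a', ha', b', hb', rfl⟩ := h'
    exact ⟨a + a', add_mem ha ha', b + b', add_mem hb hb', by rw [map_add]; abel⟩
  | single I r h =>
    by_cases hI : I.1 (Fin.last n) = m.succPNat
    · have hlt : ∀ i : Fin n, I.1 i.castSucc < m.succPNat := fun i =>
        hI ▸ I.2 (Fin.castSucc_lt_last i)
      refine ⟨0, zero_mem _,
        Finsupp.single ⟨I.1 ∘ Fin.castSucc, I.2.comp Fin.strictMono_castSucc⟩ r,
        single_mem_koszulSupported _ _ fun i => lt_succPNat_iff.1 (hlt i), ?_⟩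
      rw [zero_add, koszulSnoc_single _ _ hlt]
      congr 1
      refine Subtype.ext (funext fun i => ?_)
      induction i using Fin.lastCases with
      | last => simp [hI]
      | cast i => simp
    · refine ⟨Finsupp.single I r, single_mem_koszulSupported _ _ fun i => ?_, 0, zero_mem _,
        by simp⟩
      refine lt_succPNat_iff.1 ((I.2.monotone (Fin.le_last i)).trans_lt (lt_of_le_of_ne ?_ hI))
      rw [← PNat.coe_le_coe]
      exact h _

theorem koszulD_koszulSnoc (w : ℕ+ → R) {n m : ℕ}
    {b : {f : Fin (n + 1) → ℕ+ // StrictMono f} →₀ R} (hb : b ∈ koszulSupported R (n + 1) m) :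
    koszulD w (n + 1) (koszulSnoc R (n + 1) m.succPNat b) =
      koszulSnoc R n m.succPNat (koszulD w n b) +
        ((-1) ^ (n + 1) * w m.succPNat) • b := by
  induction hb using koszulSupported_induction with
  | zero => simp
  | add a b _ _ ha hb => simp only [map_add, smul_add, ha, hb]; abel
  | single I r h =>
    have hlt : ∀ i, I.1 i < m.succPNat := fun i => lt_succPNat_iff.2 (h i)
    rw [koszulSnoc_single I r hlt, koszulD_single, koszulD_single, map_smul, map_sum,
      Fin.sum_univ_castSucc, smul_add]
    congr 1
    · congr 1
      refine Finset.sum_congr rfl fun k _ => ?_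
      rw [koszulSnoc_single (n := n) _ _ fun i => hlt _]
      simp only [Fin.snoc_castSucc, Fin.val_castSucc]
      congr 1
      refine Subtype.ext (funext fun i => ?_)
      induction i using Fin.lastCases with
      | last => simp
      | cast i => simp [Fin.castSucc_succAbove_castSucc]
    · rw [Finsupp.smul_single, Finsupp.smul_single]
      simp only [Fin.snoc_last, Fin.val_last, smul_eq_mul, mul_comm r]
      congr 1
      refine Subtype.ext (funext fun i => ?_)
      simp

theorem koszulD_koszulSnoc_zero (w : ℕ+ → R) {m : ℕ}
    {b : {f : Fin 0 → ℕ+ // StrictMono f} →₀ R} (hb : b ∈ koszulSupported R 0 m) :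
    koszulD w 0 (koszulSnoc R 0 m.succPNat b) = w m.succPNat • b := by
  induction hb using koszulSupported_induction with
  | zero => simp
  | add a b _ _ ha hb => simp only [map_add, smul_add, ha, hb]
  | single I r h =>
    rw [koszulSnoc_single I r fun i => i.elim0, koszulD_single, Fin.sum_univ_one, Finsupp.smul_single,
      Finsupp.smul_single]
    simp only [Fin.snoc_zero, smul_eq_mul, Fin.val_zero, pow_zero, one_mul, mul_comm r]
    congr 1
    exact Subtype.ext (funext fun i => i.elim0)

theorem koszulD_zero_apply_mem (w : ℕ+ → R) {m : ℕ}
    {a : {f : Fin 1 → ℕ+ // StrictMono f} →₀ R} (ha : a ∈ koszulSupported R 1 m)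
    (J : {f : Fin 0 → ℕ+ // StrictMono f}) :
    koszulD w 0 a J ∈ Ideal.span {y | ∃ k : ℕ+, k < m.succPNat ∧ y = w k} := by
  induction ha using koszulSupported_induction with
  | zero => simp
  | add a b _ _ ha hb => rw [map_add]; exact add_mem ha hb
  | single I r h =>
    have hJ : J = ⟨I.1 ∘ (0 : Fin 1).succAbove, I.2.comp (Fin.strictMono_succAbove 0)⟩ :=
      Subtype.ext (funext fun i => i.elim0)
    rw [koszulD_single, Fin.sum_univ_one, hJ, Finsupp.smul_single, Finsupp.single_eq_same]
    simp only [Fin.val_zero, pow_zero, one_mul, smul_eq_mul]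
    exact Ideal.mul_mem_left _ _ (Ideal.subset_span ⟨_, lt_succPNat_iff.2 (h 0), rfl⟩)

theorem exists_koszulD_zero_eq_single (w : ℕ+ → R) {m : ℕ} {r : R}
    (hr : r ∈ Ideal.span {y | ∃ k : ℕ+, k < m.succPNat ∧ y = w k})
    (J : {f : Fin 0 → ℕ+ // StrictMono f}) :
    ∃ a ∈ koszulSupported R 1 m, koszulD w 0 a = Finsupp.single J r := by
  induction hr using Submodule.span_induction with
  | zero => exact ⟨0, zero_mem _, by simp⟩
  | add r s _ _ hr hs =>
    obtain ⟨a, ha, ha'⟩ := hr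
    obtain ⟨b, hb, hb'⟩ := hs
    exact ⟨a + b, add_mem ha hb, by rw [map_add, ha', hb', Finsupp.single_add]⟩
  | smul s r _ hr =>
    obtain ⟨a, ha, ha'⟩ := hr
    exact ⟨s • a, Submodule.smul_mem _ _ ha, by rw [map_smul, ha', Finsupp.smul_single]⟩
  | mem y hy =>
    obtain ⟨k, hk, rfl⟩ := hy
    refine ⟨Finsupp.single ⟨fun _ => k, Subsingleton.strictMono _⟩ 1,
      single_mem_koszulSupported _ _ fun _ => lt_succPNat_iff.1 hk, ?_⟩
    rw [koszulD_single, Fin.sum_univ_one, one_smul]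
    simp only [Fin.val_zero, pow_zero, one_mul]
    congr 1
    exact Subtype.ext (funext fun i => i.elim0)

/-- The Koszul complex on a weakly regular sequence `w₁, …, w_m` is exact in positive degrees. -/
theorem exists_koszulD_eq_of_koszulD_eq_zero {w : ℕ+ → R}
    (hreg : ∀ m : ℕ+, ∀ r : R,
      r * w m ∈ Ideal.span {y | ∃ k : ℕ+, k < m ∧ y = w k} →
        r ∈ Ideal.span {y | ∃ k : ℕ+, k < m ∧ y = w k}) (m : ℕ) :
    ∀ (n : ℕ) (z : {f : Fin (n + 1) → ℕ+ // StrictMono f} →₀ R),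
      z ∈ koszulSupported R (n + 1) m → koszulD w n z = 0 →
        ∃ y ∈ koszulSupported R (n + 2) m, koszulD w (n + 1) y = z := by
  induction m with
  | zero =>
    intro n z hz hdz
    clear hdz
    refine ⟨0, zero_mem _, ?_⟩
    induction hz using koszulSupported_induction with
    | zero => simp
    | add a b _ _ ha hb => rw [← ha, ← hb]; simp
    | single I r h => exact absurd (h 0) (not_le.2 (I.1 0).pos)
  | succ m ih =>
    intro n z hz hdz
    obtain ⟨a, ha, b, hb, rfl⟩ := exists_eq_add_koszulSnoc hz
    obtain ⟨c, hc, rfl, hac⟩ : ∃ c ∈ koszulSupported R (n + 1) m, koszulD w n c = b ∧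
        koszulD w n a + ((-1) ^ n * w m.succPNat) • b = 0 := by
      cases n with
      | zero =>
        rw [map_add, koszulD_koszulSnoc_zero w hb] at hdz
        let J : {f : Fin 0 → ℕ+ // StrictMono f} := ⟨Fin.elim0, Subsingleton.strictMono _⟩
        have hbJ : b = Finsupp.single J (b J) := by
          ext I
          obtain rfl : I = J := Subtype.ext (funext fun i => i.elim0)
          simp
        obtain ⟨c, hc, hcb⟩ := exists_koszulD_zero_eq_single w (m := m) (r := b J) (by
          refine hreg _ _ ?_
          have := koszulD_zero_apply_mem w (neg_mem ha) J
          rwa [map_neg, ← eq_neg_of_add_eq_zero_right hdz, Finsupp.smul_apply, smul_eq_mul,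
            mul_comm] at this) J
        exact ⟨c, hc, hcb.trans hbJ.symm, by simpa using hdz⟩
      | succ n =>
        rw [map_add, koszulD_koszulSnoc w hb] at hdz
        have hdb : koszulD w n b = 0 := by
          have := congrArg (koszulInit R n m.succPNat) hdz
          rwa [map_add, map_add, koszulInit_koszulSnoc (koszulD_mem_koszulSupported w hb),
            koszulInit_eq_zero (koszulD_mem_koszulSupported w ha), map_smul,
            koszulInit_eq_zero hb, smul_zero, zero_add, add_zero, map_zero] at this
        obtain ⟨c, hc, hcb⟩ := ih n b hb hdb
        exact ⟨c, hc, hcb, by simpa [hdb] using hdz⟩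
    obtain ⟨y, hy, hya⟩ := ih n (a + ((-1) ^ n * w m.succPNat) • c)
      (add_mem ha (Submodule.smul_mem _ _ hc)) (by rw [map_add, map_smul, hac])
    refine ⟨y + koszulSnoc R (n + 1) m.succPNat c,
      add_mem (koszulSupported_mono (Nat.le_succ m) hy) (koszulSnoc_mem_koszulSupported hc), ?_⟩
    rw [map_add, hya, koszulD_koszulSnoc w hc, pow_succ, mul_neg_one, neg_mul, neg_smul]
    abel

end


/-- If `x` is a nonzerodivisor and not a unit, and `w₁, w₂, …` is regular in `R` and regular
mod `x`, then every `n`-cycle `z` (`n ≥ 1`) of the generalized Koszul complex has `x • z` a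
boundary; so `x` annihilates the higher homology. -/
theorem stmt10 {R : Type*} [CommRing R] (x : R) (hx : x ∈ nonZeroDivisors R)
    (hxu : ¬ IsUnit x) (w : ℕ+ → R)
    (hreg : ∀ m : ℕ+, ∀ r : R,
      r * w m ∈ Ideal.span {y | ∃ k : ℕ+, k < m ∧ y = w k} →
        r ∈ Ideal.span {y | ∃ k : ℕ+, k < m ∧ y = w k})
    (hregx : ∀ m : ℕ+, ∀ r : R,
      r * w m ∈ Ideal.span ({x} ∪ {y | ∃ k : ℕ+, k < m ∧ y = w k}) →
        r ∈ Ideal.span ({x} ∪ {y | ∃ k : ℕ+, k < m ∧ y = w k})) :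
    ∀ n : ℕ, ∀ z : {f : Fin (n + 1) → ℕ+ // StrictMono f} →₀ R,
      koszulD (fun i => x * w i) n z = 0 →
        x • z ∈ LinearMap.range (koszulD (fun i => x * w i) (n + 1)) := by
  intro n z hz
  obtain ⟨m, hm⟩ := exists_mem_koszulSupported z
  have hdz : koszulD w n z = 0 := by
    rw [koszulD_smul] at hz
    ext I
    have hI := DFunLike.congr_fun hz I
    rw [Finsupp.smul_apply, smul_eq_mul, mul_comm] at hI
    exact (mem_nonZeroDivisors_iff_right.1 hx) _ hI
  obtain ⟨y, -, rfl⟩ := exists_koszulD_eq_of_koszulD_eq_zero hreg m n z hm hdz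
  exact ⟨y, koszulD_smul x w (n + 1) y⟩
end

section
/- Let R be a commutative ring, x ∈ R a nonzerodivisor which is not a unit, and w_1, w_2, … a sequence in R which is regular in R and whose reduction is regular in R/(x), and let (K', d') be the generalized Koszul complex with d'(e_I) = Σ_k (−1)^{k−1}·x·w_{i_k}·e_{I minus i_k} as defined below. For a strictly increasing (n+1)-tuple I = (i_1 < … < i_{n+1}) of positive integers set Δ(I) := Σ_{k=1}^{n+1} (−1)^k·w_{i_k}·e_{(i_1,…,î_k,…,i_{n+1})} ∈ K'_n. Then for every n ≥ 1, every z ∈ K'_n with d'(z) = 0 is an R-linear combination of the elements Δ(I) with I ranging over strictly increasing (n+1)-tuples of positive integers. In particular the n-th homology of (K', d') is generated as an R-module by the classes of the Δ(I). -/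
/-- `Δ(I) = Σ_{k=1}^{n+1} (−1)^k w_{i_k} e_{(i₁,…,î_k,…,i_{n+1})} ∈ K'_n` for a strictly
increasing `(n+1)`-tuple `I` (zero-based sign `(−1)^(k+1)`). -/
noncomputable def DeltaK {R : Type*} [CommRing R] (w : ℕ+ → R) (n : ℕ)
    (I : {f : Fin (n + 1) → ℕ+ // StrictMono f}) :
    {f : Fin n → ℕ+ // StrictMono f} →₀ R :=
  ∑ k : Fin (n + 1),
    Finsupp.single ⟨I.1 ∘ k.succAbove, I.2.comp (Fin.strictMono_succAbove k)⟩
      ((-1 : R) ^ ((k : ℕ) + 1) * w (I.1 k))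

namespace KoszulAux

/-- Strictly increasing `n`-tuples of positive integers. -/
abbrev Tuple (n : ℕ) := {f : Fin n → ℕ+ // StrictMono f}

/-- Removing the `k`-th entry of a tuple. -/
abbrev Tuple.erase {n : ℕ} (I : Tuple (n + 1)) (k : Fin (n + 1)) : Tuple n :=
  ⟨I.1 ∘ k.succAbove, I.2.comp (Fin.strictMono_succAbove k)⟩

/-- Appending a strictly larger entry to a tuple. -/
def Tuple.snoc {n : ℕ} (J : Tuple n) (m : ℕ+) (h : ∀ i, J.1 i < m) : Tuple (n + 1) :=
  ⟨Fin.snoc (α := fun _ => ℕ+) J.1 m, by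
    intro i j hij
    induction j using Fin.lastCases with
    | last =>
      induction i using Fin.lastCases with
      | last => exact absurd hij (lt_irrefl _)
      | cast i => simpa using h i
    | cast j =>
      induction i using Fin.lastCases with
      | last => exact absurd hij (not_lt.2 (Fin.le_last _))
      | cast i => simpa using J.2 (Fin.castSucc_lt_castSucc_iff.1 hij)⟩

lemma Tuple.snoc_castSucc {n : ℕ} (J : Tuple n) (m : ℕ+) (h : ∀ i, J.1 i < m) (i : Fin n) :
    (J.snoc m h).1 i.castSucc = J.1 i := by
  simp [Tuple.snoc]

lemma Tuple.snoc_last {n : ℕ} (J : Tuple n) (m : ℕ+) (h : ∀ i, J.1 i < m) :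
    (J.snoc m h).1 (Fin.last n) = m := by
  simp [Tuple.snoc]

lemma Tuple.erase_last_snoc {n : ℕ} (J : Tuple n) (m : ℕ+) (h : ∀ i, J.1 i < m) :
    (J.snoc m h).erase (Fin.last n) = J := by
  ext i
  simp [Tuple.snoc_castSucc]

lemma Tuple.snoc_erase_last {n : ℕ} (I : Tuple (n + 1))
    (h : ∀ i, (I.erase (Fin.last n)).1 i < I.1 (Fin.last n)) :
    (I.erase (Fin.last n)).snoc (I.1 (Fin.last n)) h = I := by
  ext i
  induction i using Fin.lastCases with
  | last => rw [Tuple.snoc_last]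
  | cast i => simp [Tuple.snoc_castSucc]

lemma Tuple.erase_castSucc_snoc {n : ℕ} (J : Tuple (n + 1)) (m : ℕ+) (h : ∀ i, J.1 i < m)
    (k : Fin (n + 1)) :
    (J.snoc m h).erase k.castSucc = (J.erase k).snoc m fun _ => h _ := by
  ext i
  induction i using Fin.lastCases with
  | last =>
    rw [Tuple.snoc_last]
    simp [Tuple.snoc_last, Fin.succAbove_of_lt_succ]
  | cast i =>
    rw [Tuple.snoc_castSucc]
    simp only [Function.comp_apply, Fin.castSucc_succAbove_castSucc, Tuple.snoc_castSucc]

variable {R : Type*} [CommRing R]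

lemma koszulD_single (w : ℕ+ → R) (n : ℕ) (I : Tuple (n + 1)) (r : R) :
    koszulD w n (Finsupp.single I r) =
      r • ∑ k : Fin (n + 1), Finsupp.single (I.erase k) ((-1 : R) ^ (k : ℕ) * w (I.1 k)) := by
  simp [koszulD]

lemma koszulD_mul_left (x : R) (w : ℕ+ → R) (n : ℕ) :
    koszulD (fun i => x * w i) n = x • koszulD w n := by
  refine Finsupp.lhom_ext fun I r => ?_
  rw [LinearMap.smul_apply, koszulD_single, koszulD_single, smul_comm]
  congr 1
  simp only [Finset.smul_sum, Finsupp.smul_single, smul_eq_mul, mul_left_comm]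

lemma DeltaK_eq_neg_koszulD (w : ℕ+ → R) (n : ℕ) (I : Tuple (n + 1)) :
    DeltaK w n I = -koszulD w n (Finsupp.single I 1) := by
  rw [koszulD_single, one_smul, ← Finset.sum_neg_distrib]
  refine Finset.sum_congr rfl fun k _ => ?_
  rw [← Finsupp.single_neg, pow_succ]
  congr 1
  ring

lemma koszulD_mem_span_DeltaK (w : ℕ+ → R) (n : ℕ) (c : Tuple (n + 1) →₀ R) :
    koszulD w n c ∈ Submodule.span R (Set.range (DeltaK w n)) := by
  induction c using Finsupp.induction_linear with
  | zero => simp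
  | add f g hf hg => rw [map_add]; exact add_mem hf hg
  | single I r =>
    have h : koszulD w n (Finsupp.single I r) = (-r) • DeltaK w n I := by
      rw [DeltaK_eq_neg_koszulD, koszulD_single, koszulD_single, one_smul, neg_smul_neg]
    rw [h]
    exact Submodule.smul_mem _ _ (Submodule.subset_span ⟨I, rfl⟩)

variable (R) in
/-- Chains involving only indices `< m`. -/
def below (m : ℕ+) (n : ℕ) : Submodule R (Tuple n →₀ R) :=
  Finsupp.supported R R {f | ∀ i, f.1 i < m}

lemma single_mem_below {m : ℕ+} {n : ℕ} {I : Tuple n} (h : ∀ i, I.1 i < m) (r : R) :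
    Finsupp.single I r ∈ below R m n :=
  Finsupp.single_mem_supported R r h

/-- A submodule containing all basis elements with indices `< m` contains `below R m n`. -/
lemma below_le {m : ℕ+} {n : ℕ} {N : Submodule R (Tuple n →₀ R)}
    (h : ∀ I : Tuple n, (∀ i, I.1 i < m) → Finsupp.single I 1 ∈ N) : below R m n ≤ N := by
  rw [below, Finsupp.supported_eq_span_single, Submodule.span_le]
  rintro _ ⟨I, hI, rfl⟩
  exact h I hI

lemma koszulD_mem_below (w : ℕ+ → R) {m : ℕ+} {n : ℕ} {z : Tuple (n + 1) →₀ R}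
    (hz : z ∈ below R m (n + 1)) : koszulD w n z ∈ below R m n := by
  refine below_le (N := (below R m n).comap (koszulD w n)) (fun I hI => ?_) hz
  rw [Submodule.mem_comap, koszulD_single]
  exact Submodule.smul_mem _ _ (sum_mem fun k _ => single_mem_below (I := I.erase k)
    (fun _ => hI _) _)

lemma exists_mem_below {n : ℕ} (z : Tuple (n + 1) →₀ R) : ∃ m, z ∈ below R m (n + 1) := by
  induction z using Finsupp.induction_linear with
  | zero => exact ⟨1, zero_mem _⟩
  | add f g hf hg =>
    obtain ⟨a, ha⟩ := hf
    obtain ⟨b, hb⟩ := hg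
    have mono : ∀ {c : ℕ+}, c ≤ max a b → below R c (n + 1) ≤ below R (max a b) (n + 1) :=
      fun hc => Finsupp.supported_mono fun _ hI i => (hI i).trans_le hc
    exact ⟨max a b, add_mem (mono (le_max_left _ _) ha) (mono (le_max_right _ _) hb)⟩
  | single I r =>
    exact ⟨I.1 (Fin.last n) + 1, single_mem_below
      (fun i => PNat.lt_add_one_iff.2 (I.2.monotone (Fin.le_last i))) r⟩

variable (R) in
open Classical in
/-- Right wedge product with `e_m` on chains involving only indices `< m`. -/
noncomputable def wedge (m : ℕ+) (n : ℕ) : (Tuple n →₀ R) →ₗ[R] (Tuple (n + 1) →₀ R) :=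
  Finsupp.linearCombination R fun J =>
    if h : ∀ i, J.1 i < m then Finsupp.single (J.snoc m h) 1 else 0

lemma wedge_single {m : ℕ+} {n : ℕ} {J : Tuple n} (h : ∀ i, J.1 i < m) (r : R) :
    wedge R m n (Finsupp.single J r) = Finsupp.single (J.snoc m h) r := by
  simp [wedge, h]

variable (R) in
/-- The coefficient of `e_m` in last position. -/
noncomputable def unwedge (m : ℕ+) (n : ℕ) : (Tuple (n + 1) →₀ R) →ₗ[R] (Tuple n →₀ R) :=
  Finsupp.linearCombination R fun I =>
    if I.1 (Fin.last n) = m then Finsupp.single (I.erase (Fin.last n)) 1 else 0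

lemma unwedge_wedge {m : ℕ+} {n : ℕ} {b : Tuple n →₀ R} (hb : b ∈ below R m n) :
    unwedge R m n (wedge R m n b) = b := by
  refine below_le (N := LinearMap.eqLocus (unwedge R m n ∘ₗ wedge R m n) LinearMap.id)
    (fun I hI => ?_) hb
  simp only [LinearMap.mem_eqLocus, LinearMap.comp_apply, wedge_single hI, LinearMap.id_apply]
  rw [unwedge, Finsupp.linearCombination_single, if_pos (Tuple.snoc_last I m hI), one_smul,
    Tuple.erase_last_snoc]

lemma unwedge_eq_zero {m : ℕ+} {n : ℕ} {a : Tuple (n + 1) →₀ R}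
    (ha : a ∈ below R m (n + 1)) : unwedge R m n a = 0 := by
  refine below_le (N := LinearMap.ker (unwedge R m n)) (fun I hI => ?_) ha
  rw [LinearMap.mem_ker, unwedge, Finsupp.linearCombination_single, if_neg (hI _).ne, smul_zero]

lemma eq_zero_of_add_wedge_eq_zero {m : ℕ+} {n : ℕ} {a : Tuple (n + 1) →₀ R}
    {b : Tuple n →₀ R} (ha : a ∈ below R m (n + 1)) (hb : b ∈ below R m n)
    (h : a + wedge R m n b = 0) : a = 0 ∧ b = 0 := by
  have hb0 : b = 0 := by
    simpa [unwedge_wedge hb, unwedge_eq_zero ha] using congrArg (unwedge R m n) h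
  subst hb0
  exact ⟨by simpa using h, rfl⟩

lemma exists_eq_add_wedge {m : ℕ+} {n : ℕ} {z : Tuple (n + 1) →₀ R}
    (hz : z ∈ below R (m + 1) (n + 1)) :
    ∃ a ∈ below R m (n + 1), ∃ b ∈ below R m n, a + wedge R m n b = z := by
  have key : below R (m + 1) (n + 1) ≤
      below R m (n + 1) ⊔ (below R m n).map (wedge R m n) := by
    refine below_le fun I hI => ?_
    by_cases hlast : I.1 (Fin.last n) = m
    · have h : ∀ i, (I.erase (Fin.last n)).1 i < m := fun i => by
        rw [← hlast]
        exact I.2 (by simp)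
      refine Submodule.mem_sup_right ⟨_, single_mem_below h 1, ?_⟩
      rw [wedge_single h]
      subst hlast
      rw [Tuple.snoc_erase_last]
    · exact Submodule.mem_sup_left (single_mem_below (fun i =>
        (I.2.monotone (Fin.le_last i)).trans_lt
          (lt_of_le_of_ne (PNat.lt_add_one_iff.1 (hI _)) hlast)) 1)
  obtain ⟨a, ha, _, ⟨b, hb, rfl⟩, h⟩ := Submodule.mem_sup.1 (key hz)
  exact ⟨a, ha, b, hb, h⟩

lemma below_mono {m : ℕ+} {n : ℕ} : below R m n ≤ below R (m + 1) n :=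
  Finsupp.supported_mono fun _ hI i => (hI i).trans (PNat.lt_add_right m 1)

lemma wedge_mem {m : ℕ+} {n : ℕ} {b : Tuple n →₀ R} (hb : b ∈ below R m n) :
    wedge R m n b ∈ below R (m + 1) (n + 1) := by
  refine below_le (N := (below R (m + 1) (n + 1)).comap (wedge R m n)) (fun I hI => ?_) hb
  rw [Submodule.mem_comap, wedge_single hI]
  refine single_mem_below (fun i => PNat.lt_add_one_iff.2 ?_) 1
  induction i using Fin.lastCases with
  | last => rw [Tuple.snoc_last]
  | cast i => rw [Tuple.snoc_castSucc]; exact (hI i).le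

lemma below_one_succ (n : ℕ) : below R 1 (n + 1) = ⊥ :=
  eq_bot_iff.2 (below_le fun _ hI => absurd (hI 0) (not_lt_of_ge one_le))

lemma koszulD_wedge_zero (w : ℕ+ → R) {m : ℕ+} {b : Tuple 0 →₀ R} (hb : b ∈ below R m 0) :
    koszulD w 0 (wedge R m 0 b) = w m • b := by
  refine below_le (N := LinearMap.eqLocus (koszulD w 0 ∘ₗ wedge R m 0) (w m • LinearMap.id))
    (fun I hI => ?_) hb
  simp only [LinearMap.mem_eqLocus, LinearMap.comp_apply, wedge_single hI, koszulD_single,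
    LinearMap.smul_apply, LinearMap.id_apply, one_smul]
  rw [Fin.sum_univ_castSucc, Tuple.erase_last_snoc, Tuple.snoc_last]
  simp

lemma koszulD_wedge_succ (w : ℕ+ → R) {m : ℕ+} {n : ℕ} {b : Tuple (n + 1) →₀ R}
    (hb : b ∈ below R m (n + 1)) :
    koszulD w (n + 1) (wedge R m (n + 1) b) =
      wedge R m n (koszulD w n b) + ((-1) ^ (n + 1) * w m) • b := by
  refine below_le (N := LinearMap.eqLocus (koszulD w (n + 1) ∘ₗ wedge R m (n + 1))
    (wedge R m n ∘ₗ koszulD w n + ((-1) ^ (n + 1) * w m) • LinearMap.id)) (fun I hI => ?_) hb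
  simp only [LinearMap.mem_eqLocus, LinearMap.comp_apply, wedge_single hI, koszulD_single,
    LinearMap.add_apply, LinearMap.smul_apply, LinearMap.id_apply, one_smul, map_sum]
  rw [Fin.sum_univ_castSucc]
  congr 1
  · refine Finset.sum_congr rfl fun k _ => ?_
    rw [Tuple.erase_castSucc_snoc, Tuple.snoc_castSucc, wedge_single (J := I.erase k) fun _ => hI _]
    rfl
  · rw [Tuple.erase_last_snoc, Tuple.snoc_last]
    simp

lemma koszulD_koszulD (w : ℕ+ → R) (n : ℕ) (z : Tuple (n + 2) →₀ R) :
    koszulD w n (koszulD w (n + 1) z) = 0 := by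
  obtain ⟨m, hz⟩ := exists_mem_below z
  induction m using PNat.recOn generalizing n with
  | one =>
    rw [below_one_succ, Submodule.mem_bot] at hz
    simp [hz]
  | succ m ih =>
    obtain ⟨a, ha, b, hb, rfl⟩ := exists_eq_add_wedge hz
    rw [map_add, map_add, ih n a ha, zero_add, koszulD_wedge_succ w hb, map_add, map_smul]
    cases n with
    | zero =>
      rw [koszulD_wedge_zero w (koszulD_mem_below w hb), ← add_smul]
      simp
    | succ n =>
      rw [koszulD_wedge_succ w (koszulD_mem_below w hb), ih n b hb, map_zero, zero_add,
        ← add_smul, pow_succ _ (n + 1)]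
      simp

/-- In degree `0` the boundaries are the multiples of `e_∅` by the ideal generated by `w`. -/
lemma exists_koszulD_eq_of_mem_span (w : ℕ+ → R) {m : ℕ+} {I : Tuple 0} {r : R}
    (hr : r ∈ Ideal.span {y | ∃ k : ℕ+, k < m ∧ y = w k}) :
    ∃ c ∈ below R m 1, koszulD w 0 c = Finsupp.single I r := by
  have key : Ideal.span {y | ∃ k : ℕ+, k < m ∧ y = w k} ≤
      ((below R m 1).map (koszulD w 0)).comap (Finsupp.lsingle I) := by
    rw [Ideal.span, Submodule.span_le]
    rintro _ ⟨k, hk, rfl⟩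
    refine ⟨Finsupp.single ⟨fun _ => k, Subsingleton.strictMono (α := Fin 1) _⟩ 1,
      single_mem_below (fun _ => hk) 1, ?_⟩
    rw [koszulD_single]
    simp [Subsingleton.elim _ I]
  exact key hr

lemma koszulD_apply_mem_span (w : ℕ+ → R) {m : ℕ+} {I : Tuple 0} {a : Tuple 1 →₀ R}
    (ha : a ∈ below R m 1) :
    koszulD w 0 a I ∈ Ideal.span {y | ∃ k : ℕ+, k < m ∧ y = w k} := by
  refine below_le (N := Submodule.comap (Finsupp.lapply I ∘ₗ koszulD w 0)
    (Ideal.span {y | ∃ k : ℕ+, k < m ∧ y = w k})) (fun J hJ => ?_) ha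
  rw [Submodule.mem_comap, LinearMap.comp_apply, koszulD_single]
  have h : w (J.1 0) ∈ Ideal.span {y | ∃ k : ℕ+, k < m ∧ y = w k} :=
    Ideal.subset_span ⟨J.1 0, hJ 0, rfl⟩
  simpa [Subsingleton.elim _ I] using h

/-- The Koszul complex of a regular sequence is exact in positive degrees, one stage at a time. -/
theorem exists_koszulD_eq_of_below (w : ℕ+ → R)
    (hreg : ∀ m : ℕ+, ∀ r : R,
      r * w m ∈ Ideal.span {y | ∃ k : ℕ+, k < m ∧ y = w k} →
        r ∈ Ideal.span {y | ∃ k : ℕ+, k < m ∧ y = w k}) (m : ℕ+) :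
    ∀ (n : ℕ) (z : Tuple (n + 1) →₀ R), z ∈ below R m (n + 1) → koszulD w n z = 0 →
      ∃ c, c ∈ below R m (n + 2) ∧ koszulD w (n + 1) c = z := by
  induction m using PNat.recOn with
  | one =>
    intro n z hz _
    rw [below_one_succ, Submodule.mem_bot] at hz
    exact ⟨0, zero_mem _, by rw [map_zero, hz]⟩
  | succ m ih =>
    intro n z hz hdz
    obtain ⟨a, ha, b, hb, rfl⟩ := exists_eq_add_wedge hz
    have hbd : ∃ c, c ∈ below R m (n + 1) ∧ koszulD w n c = b := by
      cases n with
      | zero =>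
        rw [map_add, koszulD_wedge_zero w hb] at hdz
        let I : Tuple 0 := ⟨Fin.elim0, Subsingleton.strictMono _⟩
        have hbI : b = Finsupp.single I (b I) := by
          ext J
          simp [Subsingleton.elim J I]
        rw [hbI]
        refine exists_koszulD_eq_of_mem_span w (hreg m _ ?_)
        have h := congrArg (fun f => f I) hdz
        simp only [Finsupp.add_apply, Finsupp.smul_apply, smul_eq_mul, Finsupp.zero_apply] at h
        rw [mul_comm, eq_neg_of_add_eq_zero_right h]
        exact neg_mem (koszulD_apply_mem_span w ha)
      | succ n =>
        rw [map_add, koszulD_wedge_succ w hb, add_comm (wedge R m n _), ← add_assoc] at hdz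
        exact ih n b hb (eq_zero_of_add_wedge_eq_zero
          (add_mem (koszulD_mem_below w ha) (Submodule.smul_mem _ _ hb))
          (koszulD_mem_below w hb) hdz).2
    obtain ⟨c, hc, rfl⟩ := hbd
    have hdc := koszulD_wedge_succ w hc
    have hdd := koszulD_koszulD w n (wedge R m (n + 1) c)
    obtain ⟨e, he, hde⟩ := ih n (a - ((-1) ^ (n + 1) * w m) • c)
      (sub_mem ha (Submodule.smul_mem _ _ hc)) (by
        rw [hdc, map_add] at hdd
        rw [map_add] at hdz
        rw [map_sub]
        exact sub_eq_zero.2 (add_right_cancel ((hdz.trans hdd.symm).trans (add_comm _ _))))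
    refine ⟨e + wedge R m (n + 1) c, add_mem (below_mono he) (wedge_mem hc), ?_⟩
    rw [map_add, hde, hdc]
    abel

end KoszulAux

open KoszulAux in
/-- If `x` is a nonzerodivisor and not a unit, and `w₁, w₂, …` is regular in `R` and regular
mod `x`, then every `n`-cycle (`n ≥ 1`) of the generalized Koszul complex is an `R`-linear
combination of the elements `Δ(I)`. -/
theorem stmt11 {R : Type*} [CommRing R] (x : R) (hx : x ∈ nonZeroDivisors R)
    (hxu : ¬ IsUnit x) (w : ℕ+ → R)
    (hreg : ∀ m : ℕ+, ∀ r : R,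
      r * w m ∈ Ideal.span {y | ∃ k : ℕ+, k < m ∧ y = w k} →
        r ∈ Ideal.span {y | ∃ k : ℕ+, k < m ∧ y = w k})
    (hregx : ∀ m : ℕ+, ∀ r : R,
      r * w m ∈ Ideal.span ({x} ∪ {y | ∃ k : ℕ+, k < m ∧ y = w k}) →
        r ∈ Ideal.span ({x} ∪ {y | ∃ k : ℕ+, k < m ∧ y = w k})) :
    ∀ n : ℕ, ∀ z : {f : Fin (n + 1) → ℕ+ // StrictMono f} →₀ R,
      koszulD (fun i => x * w i) n z = 0 →
        z ∈ Submodule.span R (Set.range (DeltaK w (n + 1))) := by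
  intro n z hz
  rw [koszulD_mul_left, LinearMap.smul_apply] at hz
  have hdz : koszulD w n z = 0 := by
    ext J
    have h := congrArg (fun f => f J) hz
    simp only [Finsupp.smul_apply, smul_eq_mul, Finsupp.zero_apply] at h
    exact (mul_left_mem_nonZeroDivisors_eq_zero_iff hx).1 h
  obtain ⟨m, hm⟩ := exists_mem_below z
  obtain ⟨c, -, rfl⟩ := exists_koszulD_eq_of_below w hreg m n z hm hdz
  exact koszulD_mem_span_DeltaK w (n + 1) c
end

section
/- Let p be a prime and let S be a commutative ring in which p is invertible. Let u, t_1, t_2, … be elements of S, set t_0 = 1 and v = u + p·t_1, and suppose that for every n ≥ 1 the logarithm relation Σ_{j=0}^{n} p^{−j}·u^{(p^j−1)/(p−1)}·t_{n−j}^{(p^j)} = p^{−n}·v^{(p^n−1)/(p−1)} holds in S. Then for every n ≥ 1 one has p·t_n = v^{(p^{n−1})}·t_{n−1} − u·t_{n−1}^p + Σ_{k=1}^{n−1} p^{−k}·u^{(p^k−1)/(p−1)}·( v^{(p^{n−1})}·t_{n−1−k}^{(p^k)} − u^{(p^k)}·t_{n−1−k}^{(p^{k+1})} ) in S. -/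
theorem repunit_succ {p : ℕ} (hp : 2 ≤ p) (n : ℕ) :
    (p ^ (n + 1) - 1) / (p - 1) = (p ^ n - 1) / (p - 1) + p ^ n := by
  rw [← Nat.geomSum_eq hp, ← Nat.geomSum_eq hp, Finset.sum_range_succ]

theorem sum_range_succ_eq_add_sum_Icc {M : Type*} [AddCommMonoid M] (f : ℕ → M) (m : ℕ) :
    ∑ k ∈ Finset.range (m + 1), f k = f 0 + ∑ k ∈ Finset.Icc 1 m, f k := by
  rw [Finset.range_eq_Ico, Finset.sum_eq_sum_Ico_succ_bot (Nat.succ_pos m)]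
  congr 1


/-- Equation (l*l-Units): if `u, t₁, t₂, …` (with `t₀ = 1`, `v = u + p t₁`) satisfy the
logarithm relations `Σ_{j=0}^n p^{−j} u^{(pʲ−1)/(p−1)} t_{n−j}^{pʲ} = p^{−n} v^{(pⁿ−1)/(p−1)}`
for all `n ≥ 1` in a commutative ring `S` where `p` is invertible, then for all `n ≥ 1`:
`p tₙ = v^(p^{n−1}) t_{n−1} − u t_{n−1}^p
  + Σ_{k=1}^{n−1} p^{−k} u^{(pᵏ−1)/(p−1)} (v^(p^{n−1}) t_{n−1−k}^{pᵏ} − u^{pᵏ} t_{n−1−k}^{p^{k+1}})`. -/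
theorem stmt13 {S : Type*} [CommRing S] (p : ℕ) (hp : p.Prime) [Invertible (p : S)]
    (u : S) (t : ℕ → S) (ht0 : t 0 = 1)
    (hlog : ∀ n : ℕ, 1 ≤ n →
      ∑ j ∈ Finset.range (n + 1),
          (⅟(p : S)) ^ j * u ^ ((p ^ j - 1) / (p - 1)) * (t (n - j)) ^ (p ^ j)
        = (⅟(p : S)) ^ n * (u + (p : S) * t 1) ^ ((p ^ n - 1) / (p - 1))) :
    ∀ n : ℕ, 1 ≤ n →
      (p : S) * t n =
        (u + (p : S) * t 1) ^ (p ^ (n - 1)) * t (n - 1) - u * (t (n - 1)) ^ p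
          + ∑ k ∈ Finset.Icc 1 (n - 1),
              (⅟(p : S)) ^ k * u ^ ((p ^ k - 1) / (p - 1)) *
                ((u + (p : S) * t 1) ^ (p ^ (n - 1)) * (t (n - 1 - k)) ^ (p ^ k)
                  - u ^ (p ^ k) * (t (n - 1 - k)) ^ (p ^ (k + 1))) := by
  intro n hn
  obtain ⟨m, rfl⟩ : ∃ m, n = m + 1 := ⟨n - 1, by omega⟩
  simp only [Nat.add_sub_cancel]
  generalize u + (p : S) * t 1 = v at hlog ⊢
  have hm : ∑ j ∈ Finset.range (m + 1),
      (⅟(p : S)) ^ j * u ^ ((p ^ j - 1) / (p - 1)) * (t (m - j)) ^ (p ^ j)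
        = (⅟(p : S)) ^ m * v ^ ((p ^ m - 1) / (p - 1)) := by
    rcases Nat.eq_zero_or_pos m with rfl | h
    · simp [ht0]
    · exact hlog m h
  have hsucc := hlog (m + 1) hn
  rw [Finset.sum_range_succ', repunit_succ hp.two_le] at hsucc
  have hinv : (p : S) * ⅟(p : S) = 1 := mul_invOf_self _
  have hshift : (p : S) * ∑ j ∈ Finset.range (m + 1), (⅟(p : S)) ^ (j + 1) *
        u ^ ((p ^ (j + 1) - 1) / (p - 1)) * (t (m + 1 - (j + 1))) ^ (p ^ (j + 1))
      = ∑ j ∈ Finset.range (m + 1), (⅟(p : S)) ^ j * u ^ ((p ^ j - 1) / (p - 1)) *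
          (u ^ (p ^ j) * (t (m - j)) ^ (p ^ (j + 1))) := by
    rw [Finset.mul_sum]
    refine Finset.sum_congr rfl fun j _ => ?_
    rw [repunit_succ hp.two_le, Nat.add_sub_add_right, pow_add u, pow_succ (⅟(p : S))]
    linear_combination ((⅟(p : S)) ^ j * u ^ ((p ^ j - 1) / (p - 1)) * u ^ (p ^ j) *
      (t (m - j)) ^ (p ^ (j + 1))) * hinv
  have hsum : (p : S) * t (m + 1) = ∑ k ∈ Finset.range (m + 1),
      (⅟(p : S)) ^ k * u ^ ((p ^ k - 1) / (p - 1)) *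
        (v ^ (p ^ m) * (t (m - k)) ^ (p ^ k) - u ^ (p ^ k) * (t (m - k)) ^ (p ^ (k + 1))) := by
    simp only [mul_sub, Finset.sum_sub_distrib]
    rw [← hshift]
    have hv : ∑ k ∈ Finset.range (m + 1), (⅟(p : S)) ^ k * u ^ ((p ^ k - 1) / (p - 1)) *
        (v ^ (p ^ m) * (t (m - k)) ^ (p ^ k))
        = v ^ (p ^ m) * ((⅟(p : S)) ^ m * v ^ ((p ^ m - 1) / (p - 1))) := by
      rw [← hm, Finset.mul_sum]
      exact Finset.sum_congr rfl fun k _ => by ring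
    rw [hv]
    simp only [pow_zero, Nat.sub_self, Nat.zero_div, Nat.sub_zero, one_mul, pow_one] at hsucc
    rw [pow_add v, pow_succ (⅟(p : S)) m] at hsucc
    linear_combination (p : S) * hsucc +
      ((⅟(p : S)) ^ m * v ^ ((p ^ m - 1) / (p - 1)) * v ^ (p ^ m)) * hinv
  rw [hsum, sum_range_succ_eq_add_sum_Icc]
  simp
end

section
/- Let p be a prime and let S be a commutative ring in which p is invertible. Let u, t_1, t_2, … be elements of S, set t_0 = 1 and v = u + p·t_1, and suppose that for every n ≥ 1 the logarithm relation Σ_{j=0}^{n} p^{−j}·u^{(p^j−1)/(p−1)}·t_{n−j}^{(p^j)} = p^{−n}·v^{(p^n−1)/(p−1)} holds in S. Let R ⊆ S be the subring generated by u and all the t_k (k ≥ 1) (note v ∈ R). Then for every n ≥ 1 the following congruences hold modulo the ideal of R generated by p·u: (a) p·t_n ≡ v^(p^{n−1})·t_{n−1} − u·t_{n−1}^p mod (pu); and (b) p·t_n − p^(p^{n−1})·t_1^(p^{n−1})·t_{n−1} ≡ u^(p^{n−1})·t_{n−1} − u·t_{n−1}^p mod (pu). -/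
/-- The logarithm relations, cleared of denominators over a ring in which `p` is a
non-zero-divisor, give the formula for `p * t (n + 1)` modulo `p * u`. -/
theorem dvd_mul_succ_sub_of_log_relation {R : Type*} [CommRing R] {p : ℕ}
    (hreg : IsLeftRegular (p : R)) {u v : R} {t : ℕ → R}
    (hlog : ∀ n : ℕ, ∑ j ∈ Finset.range (n + 1),
      (p : R) ^ (n - j) * u ^ (∑ i ∈ Finset.range j, p ^ i) * t (n - j) ^ p ^ j
        = v ^ (∑ i ∈ Finset.range n, p ^ i)) (n : ℕ) :
    (p : R) * u ∣ p * t (n + 1) - (v ^ p ^ n * t n - u * t n ^ p) := by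
  induction n using Nat.strong_induction_on with
  | _ n ih =>
  have hcong (m : ℕ) (hm : m < n) : (p : R) ∣ v ^ p ^ m * t m - u * t m ^ p := by
    have h := (Dvd.intro u rfl).trans (ih m hm)
    exact (dvd_sub_right (Dvd.intro _ rfl)).mp h
  have hterm (j : ℕ) (hj : j < n) :
      (p : R) ^ (n + 1) * u ∣
        (p : R) ^ (n - (j + 1)) * u ^ (∑ i ∈ Finset.range (j + 1), p ^ i)
            * t (n - (j + 1)) ^ p ^ (j + 1) * v ^ p ^ n
          - (p : R) ^ (n - (j + 1)) * u ^ (∑ i ∈ Finset.range (j + 1 + 1), p ^ i)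
            * t (n - (j + 1)) ^ p ^ (j + 1 + 1) := by
    obtain ⟨m, rfl⟩ : ∃ m, n = m + (j + 1) := ⟨n - (j + 1), by omega⟩
    obtain ⟨c, hc⟩ := dvd_sub_pow_of_dvd_sub (hcong m (by omega)) (j + 1)
    rw [mul_pow, mul_pow, ← pow_mul, ← pow_mul, ← pow_add, ← pow_succ'] at hc
    refine ⟨u ^ (∑ i ∈ Finset.range j, p ^ (i + 1)) * c, ?_⟩
    rw [Nat.add_sub_cancel, Finset.sum_range_succ _ (j + 1), pow_add,
      Finset.sum_range_succ', pow_zero, pow_succ]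
    linear_combination (p : R) ^ m * (u ^ (∑ i ∈ Finset.range j, p ^ (i + 1)) * u) * hc
  have hsucc := hlog (n + 1)
  rw [Finset.sum_range_succ (p ^ ·) n, pow_add v, ← hlog n, Finset.sum_range_succ',
    Finset.sum_range_succ' _ n, Finset.sum_range_succ' _ n] at hsucc
  simp only [Nat.add_sub_add_right, Nat.add_sub_cancel, Nat.sub_zero, Finset.sum_range_zero,
    pow_zero, mul_one, pow_one, zero_add, Finset.sum_range_one] at hsucc
  obtain ⟨c, hc⟩ := Finset.dvd_sum fun j hj ↦ hterm j (Finset.mem_range.mp hj)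
  refine ⟨c, hreg.pow n ?_⟩
  rw [add_mul, Finset.sum_mul] at hsucc
  rw [Finset.sum_sub_distrib] at hc
  dsimp only
  linear_combination hsucc + hc

/-- Lemma (pu): under the logarithm relations (with `t₀ = 1`, `v = u + p t₁`), writing `R` for
the subring of `S` generated by `u` and the `tₖ` (`k ≥ 1`), for all `n ≥ 1` one has, modulo
the ideal of `R` generated by `p·u` (i.e. up to a multiple `p·u·c` with `c ∈ R`):
(a) `p tₙ ≡ v^(p^{n−1}) t_{n−1} − u t_{n−1}^p`, and
(b) `p tₙ − p^(p^{n−1}) t₁^(p^{n−1}) t_{n−1} ≡ u^(p^{n−1}) t_{n−1} − u t_{n−1}^p`. -/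
theorem stmt14 {S : Type*} [CommRing S] (p : ℕ) (hp : p.Prime) [Invertible (p : S)]
    (u : S) (t : ℕ → S) (ht0 : t 0 = 1)
    (hlog : ∀ n : ℕ, 1 ≤ n →
      ∑ j ∈ Finset.range (n + 1),
          (⅟(p : S)) ^ j * u ^ ((p ^ j - 1) / (p - 1)) * (t (n - j)) ^ (p ^ j)
        = (⅟(p : S)) ^ n * (u + (p : S) * t 1) ^ ((p ^ n - 1) / (p - 1))) :
    ∀ n : ℕ, 1 ≤ n →
      (∃ c ∈ Subring.closure ({u} ∪ {s | ∃ k, 1 ≤ k ∧ s = t k}),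
        (p : S) * t n
            - ((u + (p : S) * t 1) ^ (p ^ (n - 1)) * t (n - 1) - u * (t (n - 1)) ^ p)
          = (p : S) * u * c) ∧
      (∃ c ∈ Subring.closure ({u} ∪ {s | ∃ k, 1 ≤ k ∧ s = t k}),
        (p : S) * t n - (p : S) ^ (p ^ (n - 1)) * (t 1) ^ (p ^ (n - 1)) * t (n - 1)
            - (u ^ (p ^ (n - 1)) * t (n - 1) - u * (t (n - 1)) ^ p)
          = (p : S) * u * c) := by
  set R := Subring.closure ({u} ∪ {s | ∃ k, 1 ≤ k ∧ s = t k})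
  have hu : u ∈ R := Subring.subset_closure (Or.inl rfl)
  have ht (k : ℕ) : t k ∈ R := by
    rcases Nat.eq_zero_or_pos k with rfl | hk
    · exact ht0 ▸ R.one_mem
    · exact Subring.subset_closure (Or.inr ⟨k, hk, rfl⟩)
  let u' : R := ⟨u, hu⟩
  let t' (k : ℕ) : R := ⟨t k, ht k⟩
  have hreg : IsLeftRegular (p : R) := fun a b hab ↦ by
    have h : (p : S) * a = p * b := by simpa using congrArg Subtype.val hab
    exact Subtype.ext ((isUnit_of_invertible (p : S)).mul_left_cancel h)
  have hcleared (n : ℕ) : ∑ j ∈ Finset.range (n + 1),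
      (p : R) ^ (n - j) * u' ^ (∑ i ∈ Finset.range j, p ^ i) * t' (n - j) ^ p ^ j
        = (u' + p * t' 1) ^ (∑ i ∈ Finset.range n, p ^ i) := by
    apply Subtype.ext
    push_cast
    rcases Nat.eq_zero_or_pos n with rfl | hn
    · simp [t', ht0]
    · have h := congrArg ((p : S) ^ n * ·) (hlog n hn)
      simp only [Finset.mul_sum, ← mul_assoc, ← mul_pow, mul_invOf_self, one_pow, one_mul,
        ← Nat.geomSum_eq hp.two_le] at h
      rw [← h]
      refine Finset.sum_congr rfl fun j hj ↦ ?_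
      obtain ⟨m, rfl⟩ := Nat.exists_eq_add_of_le' (Finset.mem_range_succ_iff.mp hj)
      have hcancel : (p : S) ^ (m + j) * ⅟(p : S) ^ j = p ^ m := by
        rw [pow_add, mul_assoc, ← mul_pow, mul_invOf_self, one_pow, mul_one]
      rw [hcancel, Nat.add_sub_cancel]
  intro n hn
  obtain ⟨n, rfl⟩ := Nat.exists_eq_add_of_le' hn
  rw [Nat.add_sub_cancel]
  obtain ⟨c, hc⟩ := dvd_mul_succ_sub_of_log_relation hreg hcleared n
  obtain ⟨r, hr⟩ := exists_add_pow_prime_pow_eq hp u' (p * t' 1) n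
  have hc' := congrArg Subtype.val hc
  have hr' := congrArg Subtype.val hr
  push_cast at hc' hr'
  refine ⟨⟨c, c.2, hc'⟩, ⟨_, (c + p * t' 1 * r * t' n).2, ?_⟩⟩
  push_cast
  rw [mul_pow] at hr'
  linear_combination hc' + t n * hr'
end
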